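/- arXiv:0808.1480 — 2 statements merged into one kernel-verified Lean document; each statement's English description precedes it below -/
import Mathlib

section
/- For every integer k ≥ 0, the Bessel moments satisfy the recursion 2304(k+4)·c_{6,k+6} − 16(k+3)(49k²+294k+500)·c_{6,k+4} + 8(k+2)(7k⁴+56k³+182k²+280k+171)·c_{6,k+2} − (k+1)⁷·c_{6,k} = 0. -/
open MeasureTheory

/-- The modified Bessel function `K₀`, via `K₀(x) = ∫₀^∞ exp(−x cosh t) dt`. -/
noncomputable def besselK0 (x : ℝ) : ℝ :=
  ∫ t in Set.Ioi (0 : ℝ), Real.exp (-x * Real.cosh t)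

/-- The Bessel moment `c_{m,k} = ∫₀^∞ x^k K₀(x)^m dx`. -/
noncomputable def besselMoment (m k : ℕ) : ℝ :=
  ∫ x in Set.Ioi (0 : ℝ), x ^ k * besselK0 x ^ m

/-- The integral `∫₀^∞ coshⁿ t · exp(−x cosh t) dt`, so that `coshLaplace 0 = K₀` and
`coshLaplace 1 = K₁`. -/
noncomputable def coshLaplace (n : ℕ) (x : ℝ) : ℝ :=
  ∫ t in Set.Ioi (0 : ℝ), Real.cosh t ^ n * Real.exp (-x * Real.cosh t)

theorem exp_le_two_mul_cosh (t : ℝ) : Real.exp t ≤ 2 * Real.cosh t := by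
  rw [Real.cosh_eq]
  linarith [Real.exp_pos (-t)]

theorem cosh_pow_mul_exp_neg_le (n : ℕ) {x : ℝ} (hx : 0 < x) (t : ℝ) :
    Real.cosh t ^ n * Real.exp (-x * Real.cosh t)
      ≤ 2 * (n + 1).factorial / x ^ (n + 1) * Real.exp (-t) := by
  have hc : 0 < Real.cosh t := Real.cosh_pos t
  have h1 := Real.pow_div_factorial_le_exp (x := x * Real.cosh t) (by positivity) (n + 1)
  have h2 := exp_le_two_mul_cosh t
  have hf : (0 : ℝ) < (n + 1).factorial := by positivity
  rw [div_le_iff₀ hf, mul_pow] at h1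
  rw [neg_mul, Real.exp_neg, Real.exp_neg, ← div_eq_mul_inv, ← div_eq_mul_inv, div_div,
    div_le_div_iff₀ (Real.exp_pos _) (by positivity)]
  calc Real.cosh t ^ n * (x ^ (n + 1) * Real.exp t)
      ≤ Real.cosh t ^ n * (x ^ (n + 1) * (2 * Real.cosh t)) := by gcongr
    _ = 2 * (x ^ (n + 1) * Real.cosh t ^ (n + 1)) := by ring
    _ ≤ 2 * (Real.exp (x * Real.cosh t) * (n + 1).factorial) := by gcongr
    _ = _ := by ring

theorem integrableOn_cosh_pow_mul_exp_neg (n : ℕ) {x : ℝ} (hx : 0 < x) :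
    IntegrableOn (fun t => Real.cosh t ^ n * Real.exp (-x * Real.cosh t)) (Set.Ioi 0) := by
  refine Integrable.mono' ((integrableOn_exp_neg_Ioi 0).const_mul
    (2 * (n + 1).factorial / x ^ (n + 1))) (by fun_prop) (Filter.Eventually.of_forall fun t => ?_)
  rw [Real.norm_of_nonneg (by have := Real.cosh_pos t; positivity)]
  exact cosh_pow_mul_exp_neg_le n hx t

theorem hasDerivAt_coshLaplace (n : ℕ) {x : ℝ} (hx : 0 < x) :
    HasDerivAt (coshLaplace n) (-coshLaplace (n + 1) x) x := by
  have h := (hasDerivAt_integral_of_dominated_loc_of_deriv_le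
    (μ := volume.restrict (Set.Ioi (0 : ℝ)))
    (F := fun x t => Real.cosh t ^ n * Real.exp (-x * Real.cosh t))
    (F' := fun x t => -(Real.cosh t ^ (n + 1) * Real.exp (-x * Real.cosh t)))
    (bound := fun t => Real.cosh t ^ (n + 1) * Real.exp (-(x / 2) * Real.cosh t))
    (Ioi_mem_nhds (half_lt_self hx)) (Filter.Eventually.of_forall fun y => by fun_prop)
    (integrableOn_cosh_pow_mul_exp_neg n hx) (by fun_prop)
    (Filter.Eventually.of_forall fun t y hy => ?_)
    (integrableOn_cosh_pow_mul_exp_neg (n + 1) (half_pos hx))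
    (Filter.Eventually.of_forall fun t y _ => ?_)).2
  · rw [integral_neg] at h
    exact h
  · have hc := Real.cosh_pos t
    have hy' : x / 2 < y := hy
    rw [norm_neg, Real.norm_of_nonneg (by positivity)]
    gcongr
  · have h1 := (((hasDerivAt_id y).neg.mul_const (Real.cosh t)).exp).const_mul (Real.cosh t ^ n)
    convert! h1 using 1
    simp only [id, Pi.neg_apply]
    ring

theorem coshLaplace_two_sub_zero {x : ℝ} (hx : 0 < x) :
    x * (coshLaplace 2 x - coshLaplace 0 x) = coshLaplace 1 x := by
  have i0 := integrableOn_cosh_pow_mul_exp_neg 0 hx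
  have i1 := integrableOn_cosh_pow_mul_exp_neg 1 hx
  have i2 := integrableOn_cosh_pow_mul_exp_neg 2 hx
  have hd : ∀ t : ℝ, HasDerivAt (fun t => Real.sinh t * Real.exp (-x * Real.cosh t))
      (Real.cosh t ^ 1 * Real.exp (-x * Real.cosh t)
        - x * (Real.cosh t ^ 2 * Real.exp (-x * Real.cosh t)
          - Real.cosh t ^ 0 * Real.exp (-x * Real.cosh t))) t := by
    intro t
    convert! (Real.hasDerivAt_sinh t).mul (((Real.hasDerivAt_cosh t).const_mul (-x)).exp) using 1
    rw [Real.cosh_sq]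
    ring
  have hlim : Filter.Tendsto (fun t => Real.sinh t * Real.exp (-x * Real.cosh t))
      Filter.atTop (nhds 0) := by
    have h0 := Real.tendsto_exp_neg_atTop_nhds_zero.const_mul
      (2 * ((1 + 1).factorial : ℝ) / x ^ (1 + 1))
    rw [mul_zero] at h0
    refine squeeze_zero_norm (fun t => ?_) h0
    refine le_trans ?_ (cosh_pow_mul_exp_neg_le 1 hx t)
    rw [norm_mul, Real.norm_of_nonneg (Real.exp_pos _).le, pow_one, Real.norm_eq_abs]
    gcongr
    exact abs_le.2 ⟨by linarith [Real.sinh_lt_cosh (-t), Real.sinh_neg t, Real.cosh_neg t],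
      (Real.sinh_lt_cosh t).le⟩
  have h := integral_Ioi_of_hasDerivAt_of_tendsto' (a := 0) (fun t _ => hd t)
    (i1.sub ((i2.sub i0).const_mul x)) hlim
  have h' := integral_sub i1 ((i2.sub i0).const_mul x)
  simp only [Pi.sub_apply] at h'
  rw [h', integral_const_mul, integral_sub i2 i0, Real.sinh_zero] at h
  simp only [coshLaplace]
  linarith

theorem rpow_mul_pow_le_exp {y : ℝ} (hy : 0 < y) {n : ℕ} (hn : n ≤ 1) :
    y ^ (1 / 8 : ℝ) * y ^ n ≤ 8 * Real.exp (y / 2) := by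
  have h1 : y ^ (1 / 8 : ℝ) ≤ 1 + y := by
    rcases le_total y 1 with h | h
    · linarith [Real.rpow_le_one hy.le h (by norm_num : (0 : ℝ) ≤ 1 / 8)]
    · have := Real.rpow_le_rpow_of_exponent_le h (by norm_num : (1 / 8 : ℝ) ≤ 1)
      rw [Real.rpow_one] at this
      linarith
  have h2 : y ^ n ≤ 1 + y := by
    interval_cases n <;> simp [hy.le]
  have h3 := Real.quadratic_le_exp_of_nonneg (x := y / 2) (by positivity)
  calc y ^ (1 / 8 : ℝ) * y ^ n ≤ (1 + y) * (1 + y) := by gcongr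
    _ ≤ 8 * Real.exp (y / 2) := by nlinarith

theorem pow_mul_cosh_pow_mul_exp_neg_le {n : ℕ} (hn : n ≤ 1) {x : ℝ} (hx : 0 < x) (t : ℝ) :
    x ^ n * (Real.cosh t ^ n * Real.exp (-x * Real.cosh t))
      ≤ 16 * (x ^ (-(1 / 8) : ℝ) * Real.exp (-(1 / 2) * x)) * Real.exp (-(1 / 8) * t) := by
  have hc : 0 < Real.cosh t := Real.cosh_pos t
  have hy : 0 < x * Real.cosh t := by positivity
  have h1 := rpow_mul_pow_le_exp hy hn
  have h2 : Real.exp (1 / 8 * t) ≤ 2 * Real.cosh t ^ (1 / 8 : ℝ) := by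
    have h3 := Real.rpow_le_rpow (Real.exp_pos t).le (exp_le_two_mul_cosh t)
      (by norm_num : (0 : ℝ) ≤ 1 / 8)
    rw [← Real.exp_mul, Real.mul_rpow zero_le_two hc.le, mul_comm t] at h3
    have h4 : (2 : ℝ) ^ (1 / 8 : ℝ) ≤ 2 := by
      simpa using Real.rpow_le_rpow_of_exponent_le one_le_two (by norm_num : (1 / 8 : ℝ) ≤ 1)
    exact h3.trans (by gcongr)
  have h5 : Real.exp (1 / 2 * x) ≤ Real.exp (x * Real.cosh t / 2) := by
    apply Real.exp_le_exp.2
    nlinarith [Real.one_le_cosh t]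
  have hxp : 0 < x ^ (1 / 8 : ℝ) := by positivity
  rw [Real.mul_rpow hx.le hc.le, mul_pow] at h1
  rw [Real.rpow_neg hx.le, neg_mul, neg_mul, neg_mul, Real.exp_neg, Real.exp_neg, Real.exp_neg,
    show 16 * ((x ^ (1 / 8 : ℝ))⁻¹ * (Real.exp (1 / 2 * x))⁻¹) * (Real.exp (1 / 8 * t))⁻¹
      = 16 / (x ^ (1 / 8 : ℝ) * Real.exp (1 / 2 * x) * Real.exp (1 / 8 * t)) by
        field_simp, ← mul_assoc, ← div_eq_mul_inv, div_le_div_iff₀ (Real.exp_pos _) (by positivity)]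
  calc x ^ n * Real.cosh t ^ n *
        (x ^ (1 / 8 : ℝ) * Real.exp (1 / 2 * x) * Real.exp (1 / 8 * t))
      ≤ x ^ n * Real.cosh t ^ n * (x ^ (1 / 8 : ℝ) * Real.exp (x * Real.cosh t / 2)
          * (2 * Real.cosh t ^ (1 / 8 : ℝ))) := by gcongr
    _ = 2 * (x ^ (1 / 8 : ℝ) * Real.cosh t ^ (1 / 8 : ℝ) * (x ^ n * Real.cosh t ^ n))
          * Real.exp (x * Real.cosh t / 2) := by ring
    _ ≤ 2 * (8 * Real.exp (x * Real.cosh t / 2)) * Real.exp (x * Real.cosh t / 2) := by gcongr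
    _ = 16 * Real.exp (x * Real.cosh t) := by
      rw [show x * Real.cosh t = x * Real.cosh t / 2 + x * Real.cosh t / 2 by ring, Real.exp_add]
      ring_nf

theorem exists_abs_pow_mul_coshLaplace_le :
    ∃ C : ℝ, 0 ≤ C ∧ ∀ n ≤ 1, ∀ x : ℝ, 0 < x →
      |x ^ n * coshLaplace n x| ≤ C * (x ^ (-(1 / 8) : ℝ) * Real.exp (-(1 / 2) * x)) := by
  refine ⟨16 * ∫ t in Set.Ioi (0 : ℝ), Real.exp (-(1 / 8) * t),
    mul_nonneg (by norm_num) (integral_nonneg fun t => (Real.exp_pos _).le),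
    fun n hn x hx => ?_⟩
  have hint : IntegrableOn (fun t : ℝ => Real.exp (-(1 / 8) * t)) (Set.Ioi 0) :=
    integrableOn_exp_mul_Ioi (by norm_num) 0
  rw [coshLaplace, ← integral_const_mul, ← Real.norm_eq_abs]
  refine (norm_integral_le_of_norm_le (hint.const_mul
    (16 * (x ^ (-(1 / 8) : ℝ) * Real.exp (-(1 / 2) * x))))
    (Filter.Eventually.of_forall fun t => ?_)).trans_eq ?_
  · rw [Real.norm_of_nonneg (by have := Real.cosh_pos t; positivity)]
    exact pow_mul_cosh_pow_mul_exp_neg_le hn hx t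
  · rw [integral_const_mul]
    ring

/-- The Euler derivative `x K₀'(x) = −x K₁(x)`. -/
noncomputable def besselTheta (x : ℝ) : ℝ := -(x * coshLaplace 1 x)

theorem besselK0_eq_coshLaplace : besselK0 = coshLaplace 0 := by
  ext x
  simp [besselK0, coshLaplace]

theorem hasDerivAt_besselK0 {x : ℝ} (hx : 0 < x) :
    HasDerivAt besselK0 (besselTheta x / x) x := by
  rw [besselK0_eq_coshLaplace]
  convert! hasDerivAt_coshLaplace 0 hx using 1
  rw [besselTheta, neg_div, mul_div_cancel_left₀ _ hx.ne']

theorem hasDerivAt_besselTheta {x : ℝ} (hx : 0 < x) :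
    HasDerivAt besselTheta (x * besselK0 x) x := by
  have h := ((hasDerivAt_id x).mul (hasDerivAt_coshLaplace 1 hx)).neg
  convert! h using 1
  rw [besselK0_eq_coshLaplace]
  simp only [id]
  linear_combination -coshLaplace_two_sub_zero hx

/-- Nontrivial products of powers of `K₀` and `x K₀'` are dominated by a power of `x` times a
decaying exponential. -/
theorem exists_abs_pow_mul_besselK0_mul_besselTheta_le (k i j : ℕ) (hij : 1 ≤ i + j) :
    ∃ C : ℝ, 0 ≤ C ∧ ∀ x : ℝ, 0 < x →
      |x ^ k * (besselK0 x ^ i * besselTheta x ^ j)|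
        ≤ C * (x ^ ((k : ℝ) - (i + j) / 8) * Real.exp (-(1 / 2) * x)) := by
  obtain ⟨C, hC, h⟩ := exists_abs_pow_mul_coshLaplace_le
  refine ⟨C ^ (i + j), by positivity, fun x hx => ?_⟩
  have h0 : |besselK0 x| ≤ C * (x ^ (-(1 / 8) : ℝ) * Real.exp (-(1 / 2) * x)) := by
    simpa [besselK0_eq_coshLaplace] using h 0 zero_le_one x hx
  have h1 : |besselTheta x| ≤ C * (x ^ (-(1 / 8) : ℝ) * Real.exp (-(1 / 2) * x)) := by
    simpa [besselTheta] using h 1 le_rfl x hx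
  rw [abs_mul, abs_mul, abs_pow, abs_pow, abs_pow, abs_of_pos hx]
  calc x ^ k * (|besselK0 x| ^ i * |besselTheta x| ^ j)
      ≤ x ^ k * ((C * (x ^ (-(1 / 8) : ℝ) * Real.exp (-(1 / 2) * x))) ^ i
          * (C * (x ^ (-(1 / 8) : ℝ) * Real.exp (-(1 / 2) * x))) ^ j) := by gcongr
    _ = C ^ (i + j) * ((x ^ k * (x ^ (-(1 / 8) : ℝ)) ^ (i + j))
          * Real.exp (-(1 / 2) * x) ^ (i + j)) := by ring
    _ ≤ C ^ (i + j) * ((x ^ k * (x ^ (-(1 / 8) : ℝ)) ^ (i + j))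
          * Real.exp (-(1 / 2) * x)) := by
        gcongr
        exact pow_le_of_le_one (Real.exp_pos _).le (Real.exp_le_one_iff.2 (by linarith)) (by omega)
    _ = _ := by
        rw [← Real.rpow_natCast x k, ← Real.rpow_natCast (x ^ (-(1 / 8) : ℝ)) (i + j), ← Real.rpow_mul hx.le,
          ← Real.rpow_add hx]
        congr 4
        push_cast
        ring

theorem integrableOn_pow_mul_besselK0_mul_besselTheta (k i j : ℕ) (hij : 1 ≤ i + j)
    (hij' : i + j ≤ 7) :
    IntegrableOn (fun x => x ^ k * (besselK0 x ^ i * besselTheta x ^ j)) (Set.Ioi 0) := by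
  obtain ⟨C, -, h⟩ := exists_abs_pow_mul_besselK0_mul_besselTheta_le k i j hij
  have hs : -1 < (k : ℝ) - (i + j) / 8 := by
    have : (i : ℝ) + j ≤ 7 := by exact_mod_cast hij'
    linarith [(Nat.cast_nonneg k : (0 : ℝ) ≤ k)]
  have hint := integrableOn_rpow_mul_exp_neg_mul_rpow hs one_pos (half_pos one_pos)
  simp only [Real.rpow_one] at hint
  refine Integrable.mono' (hint.const_mul C) ?_ ?_
  · refine ContinuousOn.aestronglyMeasurable (fun x hx => ?_) measurableSet_Ioi
    exact ((continuousAt_id.pow k).mul (((hasDerivAt_besselK0 hx).continuousAt.pow i).mul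
      ((hasDerivAt_besselTheta hx).continuousAt.pow j))).continuousWithinAt
  · filter_upwards [ae_restrict_mem measurableSet_Ioi] with x hx
    exact h x hx

/-- The mixed moment `∫₀^∞ x^k K₀(x)^i (x K₀'(x))^j dx`. -/
noncomputable def besselMixedMoment (i j k : ℕ) : ℝ :=
  ∫ x in Set.Ioi (0 : ℝ), x ^ k * (besselK0 x ^ i * besselTheta x ^ j)

theorem besselMixedMoment_recursion (i j k : ℕ) (hij : 1 ≤ i + j) (hij' : i + j ≤ 6) :
    ((k : ℝ) + 1) * besselMixedMoment i j k + i * besselMixedMoment (i - 1) (j + 1) k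
      + j * besselMixedMoment (i + 1) (j - 1) (k + 2) = 0 := by
  have i1 := integrableOn_pow_mul_besselK0_mul_besselTheta k i j hij (by omega)
  have i2 := integrableOn_pow_mul_besselK0_mul_besselTheta k (i - 1) (j + 1) (by omega) (by omega)
  have i3 := integrableOn_pow_mul_besselK0_mul_besselTheta (k + 2) (i + 1) (j - 1)
    (by omega) (by omega)
  obtain ⟨C, hC, hb⟩ := exists_abs_pow_mul_besselK0_mul_besselTheta_le (k + 1) i j hij
  have hs : 0 < ((k + 1 : ℕ) : ℝ) - (i + j) / 8 := by
    have : (i : ℝ) + j ≤ 6 := by exact_mod_cast hij'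
    push_cast
    linarith [(Nat.cast_nonneg k : (0 : ℝ) ≤ k)]
  have hd : ∀ x ∈ Set.Ioi (0 : ℝ), HasDerivAt
      (fun x => x ^ (k + 1) * (besselK0 x ^ i * besselTheta x ^ j))
      (((k : ℝ) + 1) * (x ^ k * (besselK0 x ^ i * besselTheta x ^ j))
        + i * (x ^ k * (besselK0 x ^ (i - 1) * besselTheta x ^ (j + 1)))
        + j * (x ^ (k + 2) * (besselK0 x ^ (i + 1) * besselTheta x ^ (j - 1)))) x := by
    intro x hx
    have hx0 : x ≠ 0 := ne_of_gt hx
    convert! (hasDerivAt_pow (k + 1) x).mul (((hasDerivAt_besselK0 hx).pow i).mul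
      ((hasDerivAt_besselTheta hx).pow j)) using 1
    simp only [Pi.mul_apply, Pi.pow_apply, Nat.add_sub_cancel, Nat.cast_add, Nat.cast_one]
    field_simp
    ring
  have hcont : ContinuousWithinAt
      (fun x => x ^ (k + 1) * (besselK0 x ^ i * besselTheta x ^ j)) (Set.Ici 0) 0 := by
    have h0 : Filter.Tendsto (fun x : ℝ => C * x ^ (((k + 1 : ℕ) : ℝ) - (i + j) / 8))
        (nhdsWithin 0 (Set.Ici 0)) (nhds 0) := by
      have := ((Real.continuousAt_rpow_const 0 _ (Or.inr hs.le)).const_mul C).tendsto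
      rw [Real.zero_rpow hs.ne', mul_zero] at this
      exact this.mono_left nhdsWithin_le_nhds
    rw [ContinuousWithinAt, zero_pow (Nat.succ_ne_zero k), zero_mul]
    refine squeeze_zero_norm' ?_ h0
    filter_upwards [self_mem_nhdsWithin] with x hx
    rcases (Set.mem_Ici.1 hx).eq_or_lt with rfl | hx
    · rw [Real.zero_rpow hs.ne']
      simp
    · refine (hb x hx).trans ?_
      gcongr
      exact mul_le_of_le_one_right (by positivity) (Real.exp_le_one_iff.2 (by linarith))
  have hlim : Filter.Tendsto (fun x => x ^ (k + 1) * (besselK0 x ^ i * besselTheta x ^ j))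
      Filter.atTop (nhds 0) := by
    have h0 := (tendsto_rpow_mul_exp_neg_mul_atTop_nhds_zero
      (((k + 1 : ℕ) : ℝ) - (i + j) / 8) (1 / 2) (by norm_num)).const_mul C
    rw [mul_zero] at h0
    refine squeeze_zero_norm' ?_ h0
    filter_upwards [Filter.eventually_gt_atTop 0] with x hx
    exact hb x hx
  have h := integral_Ioi_of_hasDerivAt_of_tendsto hcont hd
    (((i1.const_mul _).add (i2.const_mul _)).add (i3.const_mul _)) hlim
  have h' := integral_add ((i1.const_mul ((k : ℝ) + 1)).add (i2.const_mul (i : ℝ)))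
    (i3.const_mul (j : ℝ))
  simp only [Pi.add_apply] at h'
  rw [h', integral_add (i1.const_mul _) (i2.const_mul _), integral_const_mul, integral_const_mul,
    integral_const_mul, zero_pow (Nat.succ_ne_zero k), zero_mul, sub_zero] at h
  exact h

theorem besselMoment_eq_besselMixedMoment (m k : ℕ) :
    besselMoment m k = besselMixedMoment m 0 k := by
  simp [besselMoment, besselMixedMoment]

/-- For every integer `k ≥ 0`,
`2304(k+4) c_{6,k+6} − 16(k+3)(49k²+294k+500) c_{6,k+4}
  + 8(k+2)(7k⁴+56k³+182k²+280k+171) c_{6,k+2} − (k+1)⁷ c_{6,k} = 0`. -/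
theorem bessel_moment_six_recursion (k : ℕ) :
    2304 * ((k : ℝ) + 4) * besselMoment 6 (k + 6)
      - 16 * ((k : ℝ) + 3) * (49 * (k : ℝ) ^ 2 + 294 * k + 500) * besselMoment 6 (k + 4)
      + 8 * ((k : ℝ) + 2)
          * (7 * (k : ℝ) ^ 4 + 56 * (k : ℝ) ^ 3 + 182 * (k : ℝ) ^ 2 + 280 * k + 171)
          * besselMoment 6 (k + 2)
      - ((k : ℝ) + 1) ^ 7 * besselMoment 6 k = 0 := by
  have h (j n : ℕ) (hj : j ≤ 6) := besselMixedMoment_recursion (6 - j) j n (by omega) (by omega)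
  have a0 := h 0 k (by norm_num)
  have a1 := h 1 k (by norm_num)
  have a2 := h 2 k (by norm_num)
  have a3 := h 3 k (by norm_num)
  have a4 := h 4 k (by norm_num)
  have a5 := h 5 k (by norm_num)
  have a6 := h 6 k (by norm_num)
  have b0 := h 0 (k + 2) (by norm_num)
  have b1 := h 1 (k + 2) (by norm_num)
  have b2 := h 2 (k + 2) (by norm_num)
  have b3 := h 3 (k + 2) (by norm_num)
  have b4 := h 4 (k + 2) (by norm_num)
  have c0 := h 0 (k + 4) (by norm_num)
  have c1 := h 1 (k + 4) (by norm_num)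
  have c2 := h 2 (k + 4) (by norm_num)
  have d0 := h 0 (k + 6) (by norm_num)
  simp only [besselMoment_eq_besselMixedMoment]
  norm_num [add_assoc] at a0 a1 a2 a3 a4 a5 a6 b0 b1 b2 b3 b4 c0 c1 c2 d0
  linear_combination (-1 * (k : ℝ) ^ 6 - 6 * (k : ℝ) ^ 5 - 15 * (k : ℝ) ^ 4 - 20 * (k : ℝ) ^ 3 - 15 * (k : ℝ) ^ 2 - 6 * (k : ℝ) - 1) * a0
    + (6 * (k : ℝ) ^ 5 + 30 * (k : ℝ) ^ 4 + 60 * (k : ℝ) ^ 3 + 60 * (k : ℝ) ^ 2 + 30 * (k : ℝ) + 6) * a1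
    + (-30 * (k : ℝ) ^ 4 - 120 * (k : ℝ) ^ 3 - 180 * (k : ℝ) ^ 2 - 120 * (k : ℝ) - 30) * a2
    + (120 * (k : ℝ) ^ 3 + 360 * (k : ℝ) ^ 2 + 360 * (k : ℝ) + 120) * a3
    + (-360 * (k : ℝ) ^ 2 - 720 * (k : ℝ) - 360) * a4
    + (720 * (k : ℝ) + 720) * a5
    + (-720) * a6
    + (50 * (k : ℝ) ^ 4 + 380 * (k : ℝ) ^ 3 + 1152 * (k : ℝ) ^ 2 + 1636 * (k : ℝ) + 910) * b0
    + (-240 * (k : ℝ) ^ 3 - 1320 * (k : ℝ) ^ 2 - 2592 * (k : ℝ) - 1800) * b1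
    + (840 * (k : ℝ) ^ 2 + 3000 * (k : ℝ) + 2880) * b2
    + (-1920 * (k : ℝ) - 3360) * b3
    + (2160) * b4
    + (-544 * (k : ℝ) ^ 2 - 3016 * (k : ℝ) - 4440) * c0
    + (1584 * (k : ℝ) + 4176) * c1
    + (-2160) * c2
    + (720) * d0
end

section
/- For all integers m ≥ 1 and k ≥ 0, the Bessel moment admits the representation c_{m,k} = (k!/2^m) · ∫_{ℝ^m} dx₁⋯dx_m / (cosh(x₁)+⋯+cosh(x_m))^{k+1}, i.e. ∫₀^∞ x^k K₀(x)^m dx = (k!/2^m) · ∫_{−∞}^∞ ⋯ ∫_{−∞}^∞ (cosh(x₁)+⋯+cosh(x_m))^{−(k+1)} dx₁⋯dx_m. -/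
open MeasureTheory

lemma integrable_exp_neg_mul_cosh {x : ℝ} (hx : 0 < x) :
    Integrable fun t : ℝ => Real.exp (-x * Real.cosh t) := by
  refine (integrable_exp_neg_mul_sq (b := x / 4) (by positivity)).mono' (by fun_prop) (ae_of_all _ fun t => ?_)
  rw [Real.norm_of_nonneg (Real.exp_pos _).le, Real.exp_le_exp]
  have h : t ^ 2 / 4 ≤ Real.cosh t := by
    rw [← Real.cosh_abs, Real.cosh_eq]
    linarith [Real.quadratic_le_exp_of_nonneg (abs_nonneg t), sq_abs t, abs_nonneg t,
      Real.exp_pos (-|t|)]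
  nlinarith

lemma integral_exp_neg_mul_cosh (x : ℝ) :
    ∫ t : ℝ, Real.exp (-x * Real.cosh t) = 2 * besselK0 x := by
  simpa [besselK0] using integral_comp_abs (f := fun t => Real.exp (-x * Real.cosh t))

lemma exp_neg_mul_sum_cosh {ι : Type*} [Fintype ι] (t : ℝ) (x : ι → ℝ) :
    Real.exp (-t * ∑ i, Real.cosh (x i)) = ∏ i, Real.exp (-t * Real.cosh (x i)) := by
  rw [Finset.mul_sum, Real.exp_sum]

lemma integral_exp_neg_mul_sum_cosh (m : ℕ) (t : ℝ) :
    ∫ x : Fin m → ℝ, Real.exp (-t * ∑ i, Real.cosh (x i)) = (2 * besselK0 t) ^ m := by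
  simp_rw [exp_neg_mul_sum_cosh]
  rw [integral_fintype_prod_volume_eq_pow fun s : ℝ => Real.exp (-t * Real.cosh s),
    integral_exp_neg_mul_cosh, Fintype.card_fin]

lemma integrable_exp_neg_mul_sum_cosh (m : ℕ) {t : ℝ} (ht : 0 < t) :
    Integrable fun x : Fin m → ℝ => Real.exp (-t * ∑ i, Real.cosh (x i)) := by
  simp_rw [exp_neg_mul_sum_cosh]
  exact Integrable.fintype_prod fun _ => integrable_exp_neg_mul_cosh ht

lemma integral_pow_mul_exp_neg_mul_Ioi (k : ℕ) {r : ℝ} (hr : 0 < r) :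
    ∫ t in Set.Ioi (0 : ℝ), t ^ k * Real.exp (-t * r) = k.factorial * (r ^ (k + 1))⁻¹ := by
  have h := Real.integral_rpow_mul_exp_neg_mul_Ioi (a := k + 1) (by positivity) hr
  rw [Real.Gamma_nat_eq_factorial, add_sub_cancel_right, ← Nat.cast_add_one] at h
  simp only [one_div, Real.rpow_natCast, inv_pow] at h
  simp_rw [neg_mul, mul_comm _ r]
  rw [h, mul_comm]

/-- Tonelli's theorem for Bochner integrals of nonnegative functions whose sections are integrable;
joint integrability is not needed, since both sides vanish when it fails. -/
lemma integral_integral_swap_of_nonneg {α β : Type*} [MeasurableSpace α] [MeasurableSpace β]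
    {μ : Measure α} {ν : Measure β} [SFinite μ] [SFinite ν] {f : α → β → ℝ}
    (hf : Measurable (Function.uncurry f)) (h0 : ∀ᵐ a ∂μ, ∀ b, 0 ≤ f a b)
    (h0' : ∀ b, ∀ᵐ a ∂μ, 0 ≤ f a b)
    (h₁ : ∀ᵐ a ∂μ, Integrable (f a) ν) (h₂ : ∀ᵐ b ∂ν, Integrable (fun a => f a b) μ) :
    ∫ a, ∫ b, f a b ∂ν ∂μ = ∫ b, ∫ a, f a b ∂μ ∂ν := by
  have m₁ : AEStronglyMeasurable (fun a => ∫ b, f a b ∂ν) μ :=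
    hf.stronglyMeasurable.integral_prod_right.aestronglyMeasurable
  have m₂ : AEStronglyMeasurable (fun b => ∫ a, f a b ∂μ) ν :=
    hf.stronglyMeasurable.integral_prod_left.aestronglyMeasurable
  rw [integral_eq_lintegral_of_nonneg_ae (h0.mono fun a ha => integral_nonneg ha) m₁,
    integral_eq_lintegral_of_nonneg_ae (ae_of_all _ fun b => integral_nonneg_of_ae (h0' b)) m₂]
  congr 1
  calc ∫⁻ a, ENNReal.ofReal (∫ b, f a b ∂ν) ∂μ
      = ∫⁻ a, ∫⁻ b, ENNReal.ofReal (f a b) ∂ν ∂μ := lintegral_congr_ae <| by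
        filter_upwards [h0, h₁] with a ha hi
        exact ofReal_integral_eq_lintegral_ofReal hi (ae_of_all _ ha)
    _ = ∫⁻ b, ∫⁻ a, ENNReal.ofReal (f a b) ∂μ ∂ν :=
        lintegral_lintegral_swap hf.ennreal_ofReal.aemeasurable
    _ = ∫⁻ b, ENNReal.ofReal (∫ a, f a b ∂μ) ∂ν := lintegral_congr_ae <| by
        filter_upwards [h₂] with b hi
        exact (ofReal_integral_eq_lintegral_ofReal hi (h0' b)).symm

/-- For `m ≥ 1` and `k ≥ 0`,
`c_{m,k} = (k!/2^m) ∫_{ℝ^m} (cosh x₁ + ⋯ + cosh x_m)^{−(k+1)} dx₁⋯dx_m`. -/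
theorem bessel_moment_cosh_representation (m k : ℕ) (hm : 1 ≤ m) :
    besselMoment m k
      = (k.factorial : ℝ) / 2 ^ m
          * ∫ x : Fin m → ℝ, ((∑ i, Real.cosh (x i)) ^ (k + 1))⁻¹ := by
  have hS (x : Fin m → ℝ) : 0 < ∑ i, Real.cosh (x i) :=
    Finset.sum_pos (fun i _ => Real.cosh_pos _) ⟨⟨0, hm⟩, Finset.mem_univ _⟩
  have hpos : ∀ᵐ t ∂volume.restrict (Set.Ioi (0 : ℝ)), 0 < t :=
    ae_restrict_mem measurableSet_Ioi
  have swap := integral_integral_swap_of_nonneg (μ := volume.restrict (Set.Ioi (0 : ℝ)))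
    (ν := (volume : Measure (Fin m → ℝ)))
    (f := fun t x => t ^ k * Real.exp (-t * ∑ i, Real.cosh (x i)))
    (by unfold Function.uncurry; fun_prop)
    (hpos.mono fun t ht x => by positivity)
    (fun x => hpos.mono fun t ht => by positivity)
    (hpos.mono fun t ht => (integrable_exp_neg_mul_sum_cosh m ht).const_mul _)
    (ae_of_all _ fun x => .of_integral_ne_zero <| by
      rw [integral_pow_mul_exp_neg_mul_Ioi k (hS x)]
      have := hS x
      positivity)
  simp_rw [integral_const_mul, integral_exp_neg_mul_sum_cosh,
    integral_pow_mul_exp_neg_mul_Ioi k (hS _), integral_const_mul, mul_pow,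
    mul_left_comm _ ((2 : ℝ) ^ m), integral_const_mul] at swap
  rw [besselMoment, div_mul_eq_mul_div, ← swap]
  field_simp
end
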